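/- An ADL mechanism {F_Q} satisfying market clearing satisfies both path-independence and leverage-priority if and only if it coincides with the minimax leverage (water-filling) policy: for every state s = (q_i, E_i)_{i=1,…,n} ∈ S with ∑_i q_i > 0 and every Q ∈ (0, ∑_i q_i), x_i(s, Q) = max(q_i − (E_i/p_τ) t(Q), 0) for all i, where t(Q) is the unique solution of ∑_{j=1}^n max(q_j − (E_j/p_τ) t, 0) = Q. -/

import Mathlib

/-- A state `(q, E)` is valid if all positions are nonnegative and all equities positive. -/
def ValidState {n : ℕ} (q E : Fin n → ℝ) : Prop :=
  (∀ i, 0 ≤ q i) ∧ (∀ i, 0 < E i)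

/-- Market clearing for an ADL mechanism, described by its allocation map
`A q E Q i`; the post-ADL state is `(q_i − A q E Q i, E_i)`. -/
def MarketClearing {n : ℕ} (A : (Fin n → ℝ) → (Fin n → ℝ) → ℝ → Fin n → ℝ) : Prop :=
  ∀ q E : Fin n → ℝ, ValidState q E →
    ∀ Q : ℝ, 0 ≤ Q → Q ≤ ∑ i, q i →
      (∀ i, A q E Q i ∈ Set.Icc 0 (q i)) ∧ (∑ i, A q E Q i) = Q

/-- Path-independence: `F_{Q₁+Q₂}(s) = F_{Q₂}(F_{Q₁}(s))`, expressed on allocations. -/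
def PathIndependent {n : ℕ} (A : (Fin n → ℝ) → (Fin n → ℝ) → ℝ → Fin n → ℝ) : Prop :=
  ∀ q E : Fin n → ℝ, ValidState q E →
    ∀ Q₁ Q₂ : ℝ, 0 ≤ Q₁ → 0 ≤ Q₂ → Q₁ + Q₂ ≤ ∑ i, q i →
      ∀ i, A q E (Q₁ + Q₂) i = A q E Q₁ i + A (fun j => q j - A q E Q₁ j) E Q₂ i

/-- Leverage priority: for every valid state there is `Q̄ > 0` such that, for all
sufficiently small feasible deleveraging quantities `Q ∈ (0, Q̄]`, only accounts of
maximal state leverage `λ_i(s) = p_τ q_i / E_i` are affected. -/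
def LeveragePriority {n : ℕ} [NeZero n] (pτ : ℝ)
    (A : (Fin n → ℝ) → (Fin n → ℝ) → ℝ → Fin n → ℝ) : Prop :=
  ∀ q E : Fin n → ℝ, ValidState q E →
    ∃ Qbar > (0 : ℝ), ∀ Q : ℝ, 0 < Q → Q ≤ Qbar → Q ≤ ∑ i, q i →
      ∀ i, pτ * q i / E i
          < (Finset.univ.sup' Finset.univ_nonempty fun j => pτ * q j / E j) →
        A q E Q i = 0

theorem fill_comp1 (a x y : ℝ) (h : x ≤ y) :
    max (a - x) 0 + max (a - max (a - x) 0 - y) 0 = max (a - x) 0 := by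
  grind

theorem fill_comp2 (a x y : ℝ) (h : y ≤ x) :
    max (a - x) 0 + max (a - max (a - x) 0 - y) 0 = max (a - y) 0 := by
  grind

theorem fill_unique {n : ℕ} (q c : Fin n → ℝ) (hc : ∀ i, 0 < c i) (t u : ℝ)
    (h : (∑ j, max (q j - c j * t) 0) = ∑ j, max (q j - c j * u) 0) :
    ∀ i, max (q i - c i * t) 0 = max (q i - c i * u) 0 := by
  have key : ∀ t u : ℝ, t ≤ u → (∑ j, max (q j - c j * t) 0) = ∑ j, max (q j - c j * u) 0 →
      ∀ i, max (q i - c i * t) 0 = max (q i - c i * u) 0 := by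
    intro t u htu h i
    have h1 : ∀ j ∈ Finset.univ, max (q j - c j * u) 0 ≤ max (q j - c j * t) 0 := by
      intro j _
      have := mul_le_mul_of_nonneg_left htu (hc j).le
      exact max_le_max (by linarith) le_rfl
    exact ((Finset.sum_eq_sum_iff_of_le h1).1 h.symm i (Finset.mem_univ i)).symm
  rcases le_total t u with h' | h'
  · exact key t u h' h
  · intro i
    exact (key u t h' h.symm i).symm

theorem fill_exists {n : ℕ} (q c : Fin n → ℝ) (hq : ∀ i, 0 ≤ q i) (hc : ∀ i, 0 < c i) (Q : ℝ)
    (h0 : 0 ≤ Q) (h1 : Q ≤ ∑ i, q i) :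
    ∃ t : ℝ, 0 ≤ t ∧ (∑ j, max (q j - c j * t) 0) = Q := by
  set T : ℝ := ∑ i, q i / c i with hT
  have hnn : ∀ i ∈ Finset.univ, 0 ≤ q i / c i := fun i _ => div_nonneg (hq i) (hc i).le
  have hT0 : 0 ≤ T := Finset.sum_nonneg hnn
  have hcont : ContinuousOn (fun t : ℝ => ∑ j, max (q j - c j * t) 0) (Set.Icc 0 T) := by
    fun_prop
  have hz : (∑ j, max (q j - c j * T) 0) = 0 := by
    apply Finset.sum_eq_zero
    intro j _
    apply max_eq_right
    have := Finset.single_le_sum hnn (Finset.mem_univ j)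
    have h2 : q j / c j ≤ T := this
    rw [div_le_iff₀ (hc j)] at h2
    linarith
  have hs : (∑ j, max (q j - c j * 0) 0) = ∑ i, q i := by
    apply Finset.sum_congr rfl
    intro j _
    rw [mul_zero, sub_zero]
    exact max_eq_left (hq j)
  have := intermediate_value_Icc' hT0 hcont
  simp only [hz, hs] at this
  obtain ⟨t, ht, hQ⟩ := this ⟨h0, h1⟩
  exact ⟨t, ht.1, hQ⟩

theorem alloc_lip {n : ℕ} (A : (Fin n → ℝ) → (Fin n → ℝ) → ℝ → Fin n → ℝ)
    (hmc : MarketClearing A) (hPI : PathIndependent A) (q E : Fin n → ℝ) (hv : ValidState q E)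
    (Q Q' : ℝ) (h0 : 0 ≤ Q) (h1 : Q ≤ Q') (h2 : Q' ≤ ∑ i, q i) (i : Fin n) :
    A q E Q i ≤ A q E Q' i ∧ A q E Q' i ≤ A q E Q i + (Q' - Q) := by
  obtain ⟨hx, hxs⟩ := hmc q E hv Q h0 (h1.trans h2)
  have hv' : ValidState (fun j => q j - A q E Q j) E :=
    ⟨fun j => sub_nonneg.2 (hx j).2, hv.2⟩
  have hsum : ∑ j, (q j - A q E Q j) = (∑ j, q j) - Q := by
    rw [Finset.sum_sub_distrib, hxs]
  obtain ⟨hy, hys⟩ := hmc _ E hv' (Q' - Q) (by linarith) (by rw [hsum]; linarith)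
  have h := hPI q E hv Q (Q' - Q) h0 (by linarith) (by linarith) i
  rw [add_sub_cancel] at h
  have h3 := Finset.single_le_sum (fun j _ => (hy j).1) (Finset.mem_univ i)
  have h4 := (hy i).1
  rw [hys] at h3
  constructor <;> linarith

theorem alloc_zero {n : ℕ} [NeZero n] (p : ℝ) (hp : 0 < p)
    (A : (Fin n → ℝ) → (Fin n → ℝ) → ℝ → Fin n → ℝ)
    (hmc : MarketClearing A) (hPI : PathIndependent A) (hLP : LeveragePriority p A)
    (q E : Fin n → ℝ) (hv : ValidState q E)
    (Q : ℝ) (h0 : 0 ≤ Q) (h2 : Q ≤ ∑ i, q i) (i j : Fin n)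
    (hlt : p * (q i - A q E Q i) / E i < p * (q j - A q E Q j) / E j) :
    A q E Q i = 0 := by
  have lip := alloc_lip A hmc hPI q E hv
  have hcont : ∀ k, ContinuousOn (fun R => A q E R k) (Set.Icc 0 Q) := by
    intro k
    apply LipschitzOnWith.continuousOn (K := 1)
    apply LipschitzOnWith.of_le_add
    intro x hx y hy
    rw [Real.dist_eq]
    rcases le_total x y with h | h
    · have := (lip x y hx.1 h (hy.2.trans h2) k).1
      have := abs_nonneg (x - y)
      linarith
    · have := (lip y x hy.1 h (hx.2.trans h2) k).2
      have := le_abs_self (x - y)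
      linarith
  have loc : ∀ R, 0 ≤ R → R < Q →
      p * (q i - A q E R i) / E i < p * (q j - A q E R j) / E j →
      ∃ ε > 0, ∀ R', R < R' → R' ≤ R + ε → R' ≤ Q → A q E R' i = A q E R i := by
    intro R hR hRQ hl
    obtain ⟨hx, hxs⟩ := hmc q E hv R hR (hRQ.le.trans h2)
    have hv' : ValidState (fun j => q j - A q E R j) E :=
      ⟨fun j => sub_nonneg.2 (hx j).2, hv.2⟩
    have hsum : ∑ j, (q j - A q E R j) = (∑ j, q j) - R := by
      rw [Finset.sum_sub_distrib, hxs]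
    obtain ⟨ε, hε, H⟩ := hLP _ E hv'
    refine ⟨ε, hε, fun R' h3 h4 h5 => ?_⟩
    have h := hPI q E hv R (R' - R) hR (by linarith) (by linarith) i
    rw [add_sub_cancel] at h
    rw [h, H (R' - R) (by linarith) (by linarith) (by rw [hsum]; linarith) i, add_zero]
    exact lt_of_lt_of_le hl
      (Finset.le_sup' (fun k => p * (q k - A q E R k) / E k) (Finset.mem_univ j))
  have const : ∀ a, 0 ≤ a → a ≤ Q →
      (∀ R, a ≤ R → R ≤ Q → p * (q i - A q E R i) / E i < p * (q j - A q E R j) / E j) →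
      A q E Q i = A q E a i := by
    intro a ha haQ H
    have hcl : IsClosed ({R | A q E R i = A q E a i} ∩ Set.Icc a Q) := by
      have := ((hcont i).mono (Set.Icc_subset_Icc_left ha)).preimage_isClosed_of_isClosed
        isClosed_Icc (isClosed_singleton (x := A q E a i))
      rw [Set.inter_comm]
      exact this
    have := hcl.Icc_subset_of_forall_exists_gt rfl (by
      rintro R ⟨hR, hR1, hR2⟩ y hy
      obtain ⟨ε, hε, h⟩ := loc R (ha.trans hR1) hR2 (H R hR1 hR2.le)
      have hy' : R < y := hy
      have hpos : R < min y (min (R + ε) Q) := lt_min hy' (lt_min (by linarith) hR2)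
      refine ⟨min y (min (R + ε) Q), ?_, hpos, min_le_left _ _⟩
      exact (h _ hpos ((min_le_right _ _).trans (min_le_left _ _))
        ((min_le_right _ _).trans (min_le_right _ _))).trans hR)
    exact this ⟨haQ, le_rfl⟩
  set S : Set ℝ := Set.Icc 0 Q ∩
    (fun R => p * (q j - A q E R j) / E j - p * (q i - A q E R i) / E i) ⁻¹' Set.Iic 0 with hS
  have hScl : IsClosed S := by
    apply ContinuousOn.preimage_isClosed_of_isClosed _ isClosed_Icc isClosed_Iic
    have := hcont i
    have := hcont j
    fun_prop
  have hScomp : IsCompact S := isCompact_Icc.of_isClosed_subset hScl Set.inter_subset_left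
  rcases S.eq_empty_or_nonempty with hemp | hne
  · rw [const 0 le_rfl h0]
    · obtain ⟨hx, hxs⟩ := hmc q E hv 0 le_rfl (h0.trans h2)
      exact (Finset.sum_eq_zero_iff_of_nonneg (fun k _ => (hx k).1)).1 hxs i (Finset.mem_univ i)
    · intro R hR hR'
      by_contra hcon
      have : R ∈ S := ⟨⟨hR, hR'⟩, by
        show _ - _ ≤ (0:ℝ)
        linarith⟩
      rw [hemp] at this
      exact this
  · exfalso
    obtain ⟨a, ⟨⟨ha0, haQ⟩, hag⟩, hub⟩ := hScomp.exists_isGreatest hne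
    have hag' : p * (q j - A q E a j) / E j - p * (q i - A q E a i) / E i ≤ 0 := hag
    have hne' : a ≠ Q := by
      rintro rfl
      linarith
    have haQ' : a < Q := lt_of_le_of_ne haQ hne'
    have hconst : A q E Q i ≤ A q E a i := by
      apply le_of_forall_pos_le_add
      intro ε hε
      have hb : a < min (a + ε) Q := lt_min (by linarith) haQ'
      have := const (min (a + ε) Q) (by linarith) (min_le_right _ _) (by
        intro R hR hR'
        by_contra hcon
        have : R ∈ S := ⟨⟨by linarith, hR'⟩, by
          show _ - _ ≤ (0:ℝ)
          linarith⟩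
        have := hub this
        linarith)
      rw [this]
      have h3 := (lip a (min (a + ε) Q) ha0 hb.le ((min_le_right _ _).trans h2) i).2
      have := min_le_left (a + ε) Q
      linarith
    have hj := (lip a Q ha0 haQ h2 j).1
    have e1 : p * (q i - A q E a i) / E i ≤ p * (q i - A q E Q i) / E i := by
      have := hv.2 i
      gcongr
    have e2 : p * (q j - A q E Q j) / E j ≤ p * (q j - A q E a j) / E j := by
      have := hv.2 j
      gcongr
    linarith

/-- axiomatic characterization: a market-clearing ADL mechanism satisfies
both path-independence and leverage-priority if and only if it coincides with the
minimax leverage (water-filling) policy: on every valid state with `∑ q_i > 0` and every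
`Q ∈ (0, ∑ q_i)`, `x_i(s,Q) = max(q_i − (E_i/p_τ) t(Q), 0)` where `t(Q)` is the unique
solution of `∑_j max(q_j − (E_j/p_τ) t, 0) = Q`. -/
theorem pathIndep_levPriority_iff_waterfilling {n : ℕ} [NeZero n]
    (pτ : ℝ) (hpτ : 0 < pτ)
    (A : (Fin n → ℝ) → (Fin n → ℝ) → ℝ → Fin n → ℝ)
    (hmc : MarketClearing A) :
    (PathIndependent A ∧ LeveragePriority pτ A) ↔
      (∀ q E : Fin n → ℝ, ValidState q E → 0 < ∑ i, q i →
        ∀ Q : ℝ, 0 < Q → Q < ∑ i, q i →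
          ∀ t : ℝ, 0 ≤ t → (∑ j, max (q j - E j / pτ * t) 0) = Q →
            ∀ i, A q E Q i = max (q i - E i / pτ * t) 0) := by
  constructor
  · rintro ⟨hPI, hLP⟩ q E hv _ Q hQ0 hQ1 t _ hsum i
    have hc : ∀ k, 0 < E k / pτ := fun k => div_pos (hv.2 k) hpτ
    obtain ⟨hx, hxs⟩ := hmc q E hv Q hQ0.le hQ1.le
    obtain ⟨j, -, hj⟩ := Finset.exists_max_image Finset.univ
      (fun k => pτ * (q k - A q E Q k) / E k) Finset.univ_nonempty
    set m := pτ * (q j - A q E Q j) / E j with hm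
    have form : ∀ k, A q E Q k = max (q k - E k / pτ * m) 0 := by
      intro k
      have hE := hv.2 k
      have e : q k - A q E Q k = E k / pτ * (pτ * (q k - A q E Q k) / E k) := by
        field_simp
      rcases (hj k (Finset.mem_univ k)).lt_or_eq with h | h
      · have hz := alloc_zero pτ hpτ A hmc hPI hLP q E hv Q hQ0.le hQ1.le k j h
        have := mul_le_mul_of_nonneg_left h.le (hc k).le
        rw [hz, max_eq_right]
        linarith
      · rw [h] at e
        have := (hx k).1
        rw [max_eq_left] <;> linarith
    rw [form i]
    apply fill_unique q (fun k => E k / pτ) hc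
    rw [hsum, ← hxs]
    exact Finset.sum_congr rfl fun k _ => (form k).symm
  · intro H
    have G : ∀ q E : Fin n → ℝ, ValidState q E → ∀ Q, 0 ≤ Q → Q ≤ ∑ i, q i →
        ∃ t, 0 ≤ t ∧ ∀ i, A q E Q i = max (q i - E i / pτ * t) 0 := by
      intro q E hv Q h0 h1
      have hc : ∀ k, 0 < E k / pτ := fun k => div_pos (hv.2 k) hpτ
      obtain ⟨hx, hxs⟩ := hmc q E hv Q h0 h1
      obtain ⟨t, ht, hs⟩ := fill_exists q (fun k => E k / pτ) hv.1 hc Q h0 h1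
      rcases h0.eq_or_lt with h | h
      · refine ⟨t, ht, fun i => ?_⟩
        subst h
        rw [(Finset.sum_eq_zero_iff_of_nonneg (fun k _ => (hx k).1)).1 hxs i (Finset.mem_univ i)]
        exact ((Finset.sum_eq_zero_iff_of_nonneg (fun k _ => le_max_right _ _)).1 hs i
          (Finset.mem_univ i)).symm
      rcases h1.eq_or_lt with h' | h'
      · refine ⟨0, le_rfl, fun i => ?_⟩
        rw [mul_zero, sub_zero, max_eq_left (hv.1 i)]
        exact (Finset.sum_eq_sum_iff_of_le (fun k _ => (hx k).2)).1 (hxs.trans h') i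
          (Finset.mem_univ i)
      · exact ⟨t, ht, H q E hv (h.trans h') Q h h' t ht hs⟩
    constructor
    · intro q E hv Q₁ Q₂ h1 h2 h12 i
      have hc : ∀ k, 0 < E k / pτ := fun k => div_pos (hv.2 k) hpτ
      obtain ⟨hx, hxs⟩ := hmc q E hv Q₁ h1 (by linarith)
      have hv' : ValidState (fun j => q j - A q E Q₁ j) E :=
        ⟨fun j => sub_nonneg.2 (hx j).2, hv.2⟩
      have hsum : ∑ j, (q j - A q E Q₁ j) = (∑ j, q j) - Q₁ := by
        rw [Finset.sum_sub_distrib, hxs]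
      have hQ2 : Q₂ ≤ ∑ j, (q j - A q E Q₁ j) := by rw [hsum]; linarith
      obtain ⟨hy, hys⟩ := hmc _ E hv' Q₂ h2 hQ2
      obtain ⟨hz, hzs⟩ := hmc q E hv (Q₁ + Q₂) (by linarith) h12
      obtain ⟨t1, ht1, f1⟩ := G q E hv Q₁ h1 (by linarith)
      obtain ⟨t2, ht2, f2⟩ := G _ E hv' Q₂ h2 hQ2
      obtain ⟨t3, ht3, f3⟩ := G q E hv (Q₁ + Q₂) (by linarith) h12
      have f4 : ∀ k, A q E Q₁ k + A (fun j => q j - A q E Q₁ j) E Q₂ k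
          = max (q k - E k / pτ * min t1 t2) 0 := by
        intro k
        rw [f2 k]
        rw [f1 k]
        have hk := hc k
        rcases le_total t1 t2 with h | h
        · have := mul_le_mul_of_nonneg_left h hk.le
          rw [min_eq_left h]
          exact fill_comp1 _ _ _ this
        · have := mul_le_mul_of_nonneg_left h hk.le
          rw [min_eq_right h]
          exact fill_comp2 _ _ _ this
      rw [f4 i, f3 i]
      apply fill_unique q (fun k => E k / pτ) hc
      rw [← Finset.sum_congr rfl fun k _ => f3 k, ← Finset.sum_congr rfl fun k _ => f4 k,
        Finset.sum_add_distrib, hxs, hys, hzs]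
    · intro q E hv
      obtain ⟨j, -, hj⟩ := Finset.exists_max_image Finset.univ
        (fun k => pτ * q k / E k) Finset.univ_nonempty
      set m := pτ * q j / E j with hm
      have hsup : (Finset.univ.sup' Finset.univ_nonempty fun j => pτ * q j / E j) = m :=
        le_antisymm (Finset.sup'_le _ _ hj)
          (Finset.le_sup' (fun k => pτ * q k / E k) (Finset.mem_univ j))
      rw [hsup]
      have hcj : 0 < E j / pτ := div_pos (hv.2 j) hpτ
      set f : Fin n → ℝ := fun i =>
        if pτ * q i / E i < m then E j / pτ * (m - pτ * q i / E i) else 1 with hf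
      refine ⟨Finset.univ.inf' Finset.univ_nonempty f, ?_, ?_⟩
      · rw [gt_iff_lt, Finset.lt_inf'_iff]
        intro i _
        simp only [hf]
        split_ifs with h
        · exact mul_pos hcj (by linarith)
        · exact one_pos
      · intro Q hQ0 hQb hQs i hi
        have hQi : Q ≤ f i := hQb.trans (Finset.inf'_le _ (Finset.mem_univ i))
        simp only [hf, if_pos hi] at hQi
        obtain ⟨t, ht, F⟩ := G q E hv Q hQ0.le hQs
        obtain ⟨hx, hxs⟩ := hmc q E hv Q hQ0.le hQs
        rw [F i]
        apply max_eq_right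
        by_contra hcon
        have hci : 0 < E i / pτ := div_pos (hv.2 i) hpτ
        have hEi := hv.2 i
        have hEj := hv.2 j
        have e : q i = E i / pτ * (pτ * q i / E i) := by field_simp
        have ej : q j = E j / pτ * m := by rw [hm]; field_simp
        have hlt : t < pτ * q i / E i := by
          apply lt_of_mul_lt_mul_left _ hci.le
          linarith
        have h3 := Finset.single_le_sum (fun k _ => (hx k).1) (Finset.mem_univ j)
        rw [hxs, F j] at h3
        have h4 := (le_max_left _ _).trans h3
        have := mul_lt_mul_of_pos_left hlt hcj
        rw [mul_sub] at hQi
        linarith
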